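/- arXiv:1602.06773 — 2 statements merged into one kernel-verified Lean document; each statement's English description precedes it below -/
import Mathlib

section
/- Let Q be the 4-subspace quiver (four source vertices each with one arrow to a common sink). Define a functor ζ from the category of pairs (V, φ), where V is a k-vector space and φ: V → V is a linear endomorphism, to representations of Q, by sending (V, φ) to the representation with V × V at the sink and the four subspaces V × 0, 0 × V, Γ(1) = {(v,v)}, and Γ(φ) = {(v, φ(v))} as the images of the four sources (with the inclusion maps as arrow maps). Then ζ is a fully faithful functor; in particular, (V, φ) ≅ (V', φ') if and only if ζ(V,φ) ≅ ζ(V',φ'), and ζ(V,φ) is indecomposable if and only if (V,φ) is indecomposable. -/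
/-- A pair `(V, φ)`: a vector space with a linear endomorphism. -/
structure EndoPair (k : Type) [Field k] where
  carrier : Type
  [acg : AddCommGroup carrier]
  [mod : Module k carrier]
  endo : carrier →ₗ[k] carrier

attribute [instance] EndoPair.acg EndoPair.mod

variable {k : Type} [Field k]

/-- A morphism of pairs: a linear map intertwining the endomorphisms. -/
structure EPHom (P Q : EndoPair k) where
  toLin : P.carrier →ₗ[k] Q.carrier
  comm : ∀ x, toLin (P.endo x) = Q.endo (toLin x)

/-- An isomorphism of pairs. -/
structure EPIso (P Q : EndoPair k) where
  toLin : P.carrier ≃ₗ[k] Q.carrier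
  comm : ∀ x, toLin (P.endo x) = Q.endo (toLin x)

/-- The identity morphism of pairs. -/
def EPHom.id (P : EndoPair k) : EPHom P P := ⟨LinearMap.id, fun _ => rfl⟩

/-- Composition of morphisms of pairs. -/
def EPHom.comp {P Q R : EndoPair k} (ψ : EPHom Q R) (φ : EPHom P Q) : EPHom P R :=
  ⟨ψ.toLin.comp φ.toLin, fun x => by
    simp only [LinearMap.comp_apply]; rw [φ.comm, ψ.comm]⟩

/-- Direct sum of pairs. -/
def EndoPair.prod (P Q : EndoPair k) : EndoPair k where
  carrier := P.carrier × Q.carrier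
  endo := P.endo.prodMap Q.endo

/-- The zero pair predicate. -/
def EndoPair.IsZero (P : EndoPair k) : Prop := ∀ x : P.carrier, x = 0

/-- Indecomposability of a pair. -/
def EndoPair.Indecomposable (P : EndoPair k) : Prop :=
  ¬ P.IsZero ∧ ∀ Q R : EndoPair k, Nonempty (EPIso P (Q.prod R)) → Q.IsZero ∨ R.IsZero

/-- A representation of the 4-subspace quiver: four vertex spaces `M i`, a sink space `C`,
and maps `M i → C`. -/
structure SubRep (k : Type) [Field k] where
  C : Type
  M : Fin 4 → Type
  [acgC : AddCommGroup C]
  [modC : Module k C]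
  [acgM : ∀ i, AddCommGroup (M i)]
  [modM : ∀ i, Module k (M i)]
  f : ∀ i, M i →ₗ[k] C

attribute [instance] SubRep.acgC SubRep.modC SubRep.acgM SubRep.modM

/-- A morphism of representations of the 4-subspace quiver. -/
structure SRHom (X Y : SubRep k) where
  hC : X.C →ₗ[k] Y.C
  hM : ∀ i, X.M i →ₗ[k] Y.M i
  comm : ∀ i x, hC (X.f i x) = Y.f i (hM i x)

/-- An isomorphism of representations of the 4-subspace quiver. -/
structure SRIso (X Y : SubRep k) where
  hC : X.C ≃ₗ[k] Y.C
  hM : ∀ i, X.M i ≃ₗ[k] Y.M i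
  comm : ∀ i x, hC (X.f i x) = Y.f i (hM i x)

/-- The identity morphism. -/
def SRHom.id (X : SubRep k) : SRHom X X :=
  ⟨LinearMap.id, fun _ => LinearMap.id, fun _ _ => rfl⟩

/-- Composition of morphisms. -/
def SRHom.comp {X Y Z : SubRep k} (ψ : SRHom Y Z) (φ : SRHom X Y) : SRHom X Z where
  hC := ψ.hC.comp φ.hC
  hM i := (ψ.hM i).comp (φ.hM i)
  comm i x := by simp only [LinearMap.comp_apply]; rw [φ.comm, ψ.comm]

/-- Direct sum of representations. -/
def SubRep.prod (X Y : SubRep k) : SubRep k where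
  C := X.C × Y.C
  M i := X.M i × Y.M i
  acgM i := inferInstanceAs (AddCommGroup (X.M i × Y.M i))
  modM i := inferInstanceAs (Module k (X.M i × Y.M i))
  f i := (X.f i).prodMap (Y.f i)

/-- The zero representation predicate. -/
def SubRep.IsZero (X : SubRep k) : Prop :=
  (∀ x : X.C, x = 0) ∧ ∀ i, ∀ x : X.M i, x = 0

/-- Indecomposability. -/
def SubRep.Indecomposable (X : SubRep k) : Prop :=
  ¬ X.IsZero ∧ ∀ Y Z : SubRep k, Nonempty (SRIso X (Y.prod Z)) → Y.IsZero ∨ Z.IsZero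

/-- The four subspaces of `V × V` attached to `(V, φ)`:
`V × 0`, `0 × V`, `Γ(1) = {(v, v)}` and `Γ(φ) = {(v, φ v)}`. -/
def zsub (P : EndoPair k) : Fin 4 → Submodule k (P.carrier × P.carrier) := fun i =>
  match i with
  | ⟨0, _⟩ => LinearMap.range (LinearMap.prod LinearMap.id (0 : P.carrier →ₗ[k] P.carrier))
  | ⟨1, _⟩ => LinearMap.range (LinearMap.prod (0 : P.carrier →ₗ[k] P.carrier) LinearMap.id)
  | ⟨2, _⟩ => LinearMap.range (LinearMap.prod LinearMap.id LinearMap.id)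
  | ⟨3, _⟩ => LinearMap.range (LinearMap.prod LinearMap.id P.endo)
  | ⟨n + 4, h⟩ => absurd h (by omega)

/-- The functor `ζ` on objects: `(V, φ)` is sent to the representation of the 4-subspace
quiver with `V × V` at the sink and the four subspaces `V × 0`, `0 × V`, `Γ(1)`, `Γ(φ)`
with their inclusion maps. -/
def zeta (P : EndoPair k) : SubRep k where
  C := P.carrier × P.carrier
  M i := ↥(zsub P i)
  acgM i := inferInstanceAs (AddCommGroup ↥(zsub P i))
  modM i := inferInstanceAs (Module k ↥(zsub P i))
  f i := (zsub P i).subtype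

/-- The functor `ζ` on morphisms. -/
def zetaHom {P Q : EndoPair k} (h : EPHom P Q) : SRHom (zeta P) (zeta Q) where
  hC := h.toLin.prodMap h.toLin
  hM i := (h.toLin.prodMap h.toLin).restrict (p := zsub P i) (q := zsub Q i) (by
    intro x hx
    fin_cases i <;>
    · simp only [zsub] at hx ⊢
      obtain ⟨v, rfl⟩ := hx
      exact ⟨h.toLin v, by simp [h.comm]⟩)
  comm i x := rfl

theorem mem_zsub_iff {P : EndoPair k} {x : P.carrier × P.carrier} :
    (x ∈ zsub P 0 ↔ x.2 = 0) ∧ (x ∈ zsub P 1 ↔ x.1 = 0) ∧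
      (x ∈ zsub P 2 ↔ x.2 = x.1) ∧ (x ∈ zsub P 3 ↔ x.2 = P.endo x.1) := by
  obtain ⟨a, b⟩ := x
  simp only [zsub, LinearMap.mem_range]
  refine ⟨?_, ?_, ?_, ?_⟩ <;> simp [eq_comm]

theorem SRHom.ext_of_hC {X Y : SubRep k} (hY : ∀ i, Function.Injective (Y.f i))
    {g h : SRHom X Y} (hC : g.hC = h.hC) : g = h := by
  have hM : g.hM = h.hM := by
    funext i
    ext x
    apply hY i
    rw [← g.comm, ← h.comm, hC]
  cases g
  cases h
  cases hC
  cases hM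
  rfl

theorem zeta_f_injective (P : EndoPair k) (i : Fin 4) : Function.Injective ((zeta P).f i) :=
  Subtype.val_injective

/-- A morphism between objects in the image of `ζ` maps each subspace into the corresponding
one. -/
theorem SRHom.hC_mem_zsub {P Q : EndoPair k} (g : SRHom (zeta P) (zeta Q)) (i : Fin 4)
    {x : P.carrier × P.carrier} (hx : x ∈ zsub P i) :
    (g.hC x : Q.carrier × Q.carrier) ∈ zsub Q i := by
  let y : zsub Q i := g.hM i ⟨x, hx⟩
  have h : g.hC x = y.1 := g.comm i ⟨x, hx⟩
  exact h ▸ y.2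

theorem zetaHom_injective (P Q : EndoPair k) :
    Function.Injective (fun φ : EPHom P Q => zetaHom φ) := by
  rintro ⟨f, hf⟩ ⟨g, hg⟩ h
  have hC : f.prodMap f = g.prodMap g := congrArg SRHom.hC h
  have hfg : f = g := by
    ext v
    exact congrArg Prod.fst (LinearMap.congr_fun hC (v, 0))
  cases hfg
  rfl

theorem zetaHom_surjective (P Q : EndoPair k) :
    Function.Surjective (fun φ : EPHom P Q => zetaHom φ) := by
  intro g
  let G : P.carrier × P.carrier →ₗ[k] Q.carrier × Q.carrier := g.hC
  have hG : ∀ i x, x ∈ zsub P i → G x ∈ zsub Q i := fun i _ hx => g.hC_mem_zsub i hx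
  have h₀ (v) : (G (v, 0)).2 = 0 := mem_zsub_iff.1.1 (hG 0 _ (mem_zsub_iff.1.2 rfl))
  have h₁ (v) : (G (0, v)).1 = 0 := mem_zsub_iff.2.1.1 (hG 1 _ (mem_zsub_iff.2.1.2 rfl))
  have hsum (a b) : G (a, b) = ((G (a, 0)).1, (G (0, b)).2) := by
    have : G (a, b) = G (a, 0) + G (0, b) := by rw [← map_add]; simp
    rw [this]
    ext <;> simp [h₀, h₁]
  have h₂ (v) : (G (0, v)).2 = (G (v, 0)).1 := by
    have := mem_zsub_iff.2.2.1.1 (hG 2 (v, v) (mem_zsub_iff.2.2.1.2 rfl))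
    rwa [hsum] at this
  have h₃ (v) : (G (P.endo v, 0)).1 = Q.endo (G (v, 0)).1 := by
    have := mem_zsub_iff.2.2.2.1 (hG 3 (v, P.endo v) (mem_zsub_iff.2.2.2.2 rfl))
    rwa [hsum, h₂] at this
  refine ⟨⟨LinearMap.fst k _ _ ∘ₗ G ∘ₗ LinearMap.inl k _ _, h₃⟩,
    SRHom.ext_of_hC (zeta_f_injective Q) ?_⟩
  refine LinearMap.ext fun ⟨a, b⟩ => ?_
  change ((G (a, 0)).1, (G (b, 0)).1) = G (a, b)
  rw [hsum a b, h₂]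

theorem zetaHom_id (P : EndoPair k) : zetaHom (EPHom.id P) = SRHom.id (zeta P) :=
  SRHom.ext_of_hC (zeta_f_injective P) rfl

theorem zetaHom_comp {P Q R : EndoPair k} (φ : EPHom P Q) (ψ : EPHom Q R) :
    zetaHom (ψ.comp φ) = (zetaHom ψ).comp (zetaHom φ) :=
  SRHom.ext_of_hC (zeta_f_injective R) rfl

/-- The morphism underlying an isomorphism of pairs. -/
def EPIso.hom {P Q : EndoPair k} (e : EPIso P Q) : EPHom P Q := ⟨e.toLin, e.comm⟩

/-- The inverse of an isomorphism of pairs. -/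
def EPIso.symm {P Q : EndoPair k} (e : EPIso P Q) : EPIso Q P :=
  ⟨e.toLin.symm, fun x => by
    rw [LinearEquiv.symm_apply_eq, e.comm, LinearEquiv.apply_symm_apply]⟩

/-- The morphism underlying an isomorphism of representations. -/
def SRIso.hom {X Y : SubRep k} (e : SRIso X Y) : SRHom X Y :=
  ⟨e.hC, fun i => e.hM i, e.comm⟩

/-- The inverse of an isomorphism of representations. -/
def SRIso.symm {X Y : SubRep k} (e : SRIso X Y) : SRIso Y X :=
  ⟨e.hC.symm, fun i => (e.hM i).symm, fun i x => by
    rw [LinearEquiv.symm_apply_eq, e.comm, LinearEquiv.apply_symm_apply]⟩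

/-- Mutually inverse morphisms of pairs form an isomorphism. -/
def EPIso.ofHom {P Q : EndoPair k} (f : EPHom P Q) (g : EPHom Q P)
    (hfg : f.comp g = EPHom.id Q) (hgf : g.comp f = EPHom.id P) : EPIso P Q :=
  ⟨LinearEquiv.ofLinearMap f.toLin g.toLin (congrArg EPHom.toLin hfg)
    (congrArg EPHom.toLin hgf), f.comm⟩

/-- Mutually inverse morphisms of representations form an isomorphism. -/
def SRIso.ofHom {X Y : SubRep k} (f : SRHom X Y) (g : SRHom Y X)
    (hfg : f.comp g = SRHom.id Y) (hgf : g.comp f = SRHom.id X) : SRIso X Y :=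
  ⟨LinearEquiv.ofLinearMap f.hC g.hC (congrArg SRHom.hC hfg) (congrArg SRHom.hC hgf),
    fun i => LinearEquiv.ofLinearMap (f.hM i) (g.hM i)
      (congrFun (congrArg SRHom.hM hfg) i) (congrFun (congrArg SRHom.hM hgf) i), f.comm⟩

theorem nonempty_EPIso_iff (P Q : EndoPair k) :
    Nonempty (EPIso P Q) ↔ Nonempty (SRIso (zeta P) (zeta Q)) := by
  constructor
  · rintro ⟨e⟩
    refine ⟨SRIso.ofHom (zetaHom e.hom) (zetaHom e.symm.hom) ?_ ?_⟩
    · refine SRHom.ext_of_hC (zeta_f_injective Q) (LinearMap.ext fun x => ?_)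
      exact Prod.ext (e.toLin.apply_symm_apply _) (e.toLin.apply_symm_apply _)
    · refine SRHom.ext_of_hC (zeta_f_injective P) (LinearMap.ext fun x => ?_)
      exact Prod.ext (e.toLin.symm_apply_apply _) (e.toLin.symm_apply_apply _)
  · rintro ⟨e⟩
    obtain ⟨f, hf : zetaHom f = e.hom⟩ := zetaHom_surjective P Q e.hom
    obtain ⟨g, hg : zetaHom g = e.symm.hom⟩ := zetaHom_surjective Q P e.symm.hom
    refine ⟨EPIso.ofHom f g (zetaHom_injective Q Q ?_) (zetaHom_injective P P ?_)⟩ <;>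
      simp only [zetaHom_comp, zetaHom_id, hf, hg]
    · exact SRHom.ext_of_hC (zeta_f_injective Q)
        (LinearMap.ext fun x => e.hC.apply_symm_apply x)
    · exact SRHom.ext_of_hC (zeta_f_injective P)
        (LinearMap.ext fun x => e.hC.symm_apply_apply x)

/-- Under an isomorphism `P ≅ Q ⊕ R`, each subspace of `P` corresponds to the sum of the
corresponding subspaces of `Q` and `R`. -/
theorem mem_zsub_iff_of_EPIso_prod {P Q R : EndoPair k} (e : EPIso P (Q.prod R)) (i : Fin 4)
    (x : P.carrier × P.carrier) :
    x ∈ zsub P i ↔ ((e.toLin x.1).1, (e.toLin x.2).1) ∈ zsub Q i ∧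
      ((e.toLin x.1).2, (e.toLin x.2).2) ∈ zsub R i := by
  have key (a b : P.carrier) :
      a = b ↔ (e.toLin a).1 = (e.toLin b).1 ∧ (e.toLin a).2 = (e.toLin b).2 := by
    rw [← e.toLin.injective.eq_iff]
    exact Prod.ext_iff
  have hz : e.toLin 0 = (0 : Q.carrier × R.carrier) := map_zero _
  have he (v) : e.toLin (P.endo v) = (Q.endo (e.toLin v).1, R.endo (e.toLin v).2) := e.comm v
  fin_cases i
  · refine mem_zsub_iff.1.trans (Iff.trans ?_ (and_congr mem_zsub_iff.1 mem_zsub_iff.1).symm)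
    rw [key, hz]
    rfl
  · refine mem_zsub_iff.2.1.trans
      (Iff.trans ?_ (and_congr mem_zsub_iff.2.1 mem_zsub_iff.2.1).symm)
    rw [key, hz]
    rfl
  · refine mem_zsub_iff.2.2.1.trans
      (Iff.trans ?_ (and_congr mem_zsub_iff.2.2.1 mem_zsub_iff.2.2.1).symm)
    rw [key]
  · refine mem_zsub_iff.2.2.2.trans
      (Iff.trans ?_ (and_congr mem_zsub_iff.2.2.2 mem_zsub_iff.2.2.2).symm)
    rw [key, he]

/-- The functor `ζ` sends a direct sum decomposition to a direct sum decomposition. -/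
def EPIso.zetaProd {P Q R : EndoPair k} (e : EPIso P (Q.prod R)) :
    SRIso (zeta P) ((zeta Q).prod (zeta R)) :=
  let E : P.carrier ≃ₗ[k] Q.carrier × R.carrier := e.toLin
  let F : (P.carrier × P.carrier) ≃ₗ[k]
      (Q.carrier × Q.carrier) × (R.carrier × R.carrier) :=
    (E.prodCongr E).trans (LinearEquiv.prodProdProdComm k _ _ _ _)
  have hF (i) (x) : x ∈ zsub P i ↔ (F x).1 ∈ zsub Q i ∧ (F x).2 ∈ zsub R i :=
    mem_zsub_iff_of_EPIso_prod e i x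
  { hC := F
    hM := fun i =>
      show zsub P i ≃ₗ[k] zsub Q i × zsub R i from
      { toFun := fun x => (⟨(F x).1, ((hF i x).1 x.2).1⟩, ⟨(F x).2, ((hF i x).1 x.2).2⟩)
        map_add' := fun x y => by ext <;> simp
        map_smul' := fun c x => by ext <;> simp
        invFun := fun y => ⟨F.symm (y.1, y.2), (hF i _).2 (by simp)⟩
        left_inv := fun x => Subtype.ext (F.symm_apply_apply x)
        right_inv := fun y => by
          ext <;> simp only [LinearEquiv.apply_symm_apply] }
    comm := fun _ _ => rfl }

/-- An idempotent endomorphism of an indecomposable pair is zero or the identity. -/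
theorem EndoPair.Indecomposable.idempotent_trivial {P : EndoPair k} (hP : P.Indecomposable)
    (e : EPHom P P) (he : e.comp e = e) : (∀ x, e.toLin x = 0) ∨ ∀ x, e.toLin x = x := by
  have hidem (x) : e.toLin (e.toLin x) = e.toLin x :=
    LinearMap.congr_fun (congrArg EPHom.toLin he) x
  have hcompl : IsCompl (LinearMap.range e.toLin) (LinearMap.ker e.toLin) :=
    LinearMap.IsIdempotentElem.isCompl (LinearMap.ext hidem)
  let Q : EndoPair k :=
    ⟨LinearMap.range e.toLin, P.endo.restrict (by
      rintro _ ⟨v, rfl⟩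
      exact ⟨P.endo v, e.comm v⟩)⟩
  let R : EndoPair k :=
    ⟨LinearMap.ker e.toLin, P.endo.restrict (by
      intro v hv
      rw [LinearMap.mem_ker] at hv ⊢
      rw [e.comm, hv, map_zero])⟩
  let f : EPIso (Q.prod R) P := ⟨Submodule.prodEquivOfIsCompl _ _ hcompl, fun x => by
    change ((P.endo x.1.1 : P.carrier) + P.endo x.2.1) = P.endo (x.1.1 + x.2.1)
    rw [map_add]⟩
  rcases hP.2 Q R ⟨f.symm⟩ with h | h
  · exact .inl fun x => congrArg Subtype.val (h ⟨e.toLin x, x, rfl⟩)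
  · refine .inr fun x => ?_
    have := congrArg Subtype.val (h ⟨x - e.toLin x, by simp [hidem]⟩)
    exact (sub_eq_zero.1 this).symm

/-- The idempotent endomorphism of a direct sum projecting to the first summand. -/
def SRIso.projFst {X Y Z : SubRep k} (e : SRIso X (Y.prod Z)) : SRHom X X :=
  e.symm.hom.comp (SRHom.comp
    ⟨(LinearMap.inl k Y.C Z.C).comp (LinearMap.fst k Y.C Z.C),
      fun i => (LinearMap.inl k (Y.M i) (Z.M i)).comp (LinearMap.fst k (Y.M i) (Z.M i)),
      fun i _ => Prod.ext rfl (map_zero (Z.f i)).symm⟩ e.hom)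

theorem SRIso.apply_projFst {X Y Z : SubRep k} (e : SRIso X (Y.prod Z)) (x : X.C) :
    e.hC (e.projFst.hC x) = (((e.hC x).1, 0) : Y.C × Z.C) :=
  e.hC.apply_symm_apply _

theorem EndoPair.Indecomposable.zeta {P : EndoPair k} (hP : P.Indecomposable) :
    (_root_.zeta P).Indecomposable := by
  refine ⟨fun h => hP.1 fun x => congrArg Prod.fst (h.1 (x, x)), ?_⟩
  rintro Y Z ⟨e⟩
  obtain ⟨p, hp : zetaHom p = e.projFst⟩ := zetaHom_surjective P P e.projFst
  have hidem : e.projFst.comp e.projFst = e.projFst := by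
    refine SRHom.ext_of_hC (zeta_f_injective P) (LinearMap.ext fun x => e.hC.injective ?_)
    change e.hC (e.projFst.hC (e.projFst.hC x)) = _
    rw [e.apply_projFst, e.apply_projFst]
  have hpp : p.comp p = p :=
    zetaHom_injective P P (by simp only [zetaHom_comp, hp, hidem])
  have hinj (i) : Function.Injective ((Y.prod Z).f i) := fun a b hab =>
    (e.symm.hM i).injective (zeta_f_injective P i (by
      rw [← e.symm.comm, ← e.symm.comm, hab]))
  have hproj (x : P.carrier × P.carrier) :
      e.projFst.hC x = (p.toLin x.1, p.toLin x.2) := by rw [← hp]; rfl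
  have hY0 (hC : ∀ y : Y.C, y = 0) : Y.IsZero := ⟨hC, fun i y => congrArg Prod.fst
    (hinj i (a₁ := ((y, 0) : Y.M i × Z.M i)) (a₂ := ((0, 0) : Y.M i × Z.M i))
      (Prod.ext ((hC _).trans (hC _).symm) rfl))⟩
  have hZ0 (hC : ∀ z : Z.C, z = 0) : Z.IsZero := ⟨hC, fun i z => congrArg Prod.snd
    (hinj i (a₁ := ((0, z) : Y.M i × Z.M i)) (a₂ := ((0, 0) : Y.M i × Z.M i))
      (Prod.ext rfl ((hC _).trans (hC _).symm)))⟩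
  have hsurj (w : Y.C × Z.C) : ∃ x, e.hC x = w := e.hC.surjective w
  rcases hP.idempotent_trivial p hpp with h | h
  · refine .inl (hY0 fun y => ?_)
    obtain ⟨x, hx⟩ := hsurj (y, 0)
    have h1 := e.apply_projFst x
    have h2 : e.projFst.hC x = 0 := (hproj x).trans (Prod.ext (h _) (h _))
    rw [h2, map_zero, hx] at h1
    exact (congrArg Prod.fst h1).symm
  · refine .inr (hZ0 fun z => ?_)
    obtain ⟨x, hx⟩ := hsurj (0, z)
    have h1 := e.apply_projFst x
    have h2 : e.projFst.hC x = x := (hproj x).trans (Prod.ext (h _) (h _))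
    rw [h2, hx] at h1
    exact congrArg Prod.snd h1

theorem EndoPair.Indecomposable.of_zeta {P : EndoPair k} (h : (_root_.zeta P).Indecomposable) :
    P.Indecomposable := by
  refine ⟨fun hP => h.1 ⟨fun x => Prod.ext (hP _) (hP _),
    fun i x => Subtype.ext (Prod.ext (hP _) (hP _))⟩, ?_⟩
  rintro Q R ⟨e⟩
  rcases h.2 _ _ ⟨e.zetaProd⟩ with h | h
  · exact .inl fun x => congrArg Prod.fst (h.1 (x, x))
  · exact .inr fun x => congrArg Prod.fst (h.1 (x, x))

/-- `ζ` is a fully faithful functor from pairs `(V, φ)` to representations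
of the 4-subspace quiver; in particular `(V, φ) ≅ (V', φ')` iff `ζ(V,φ) ≅ ζ(V',φ')`, and
`ζ(V,φ)` is indecomposable iff `(V,φ)` is indecomposable. -/
theorem stmt18 (k : Type) [Field k] :
    (∀ P : EndoPair k, zetaHom (EPHom.id P) = SRHom.id (zeta P)) ∧
    (∀ (P Q R : EndoPair k) (φ : EPHom P Q) (ψ : EPHom Q R),
      zetaHom (ψ.comp φ) = (zetaHom ψ).comp (zetaHom φ)) ∧
    (∀ P Q : EndoPair k, Function.Bijective (fun φ : EPHom P Q => zetaHom φ)) ∧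
    (∀ P Q : EndoPair k, Nonempty (EPIso P Q) ↔ Nonempty (SRIso (zeta P) (zeta Q))) ∧
    (∀ P : EndoPair k, P.Indecomposable ↔ (zeta P).Indecomposable) := by
  exact ⟨zetaHom_id, fun _ _ _ => zetaHom_comp,
    fun P Q => ⟨zetaHom_injective P Q, zetaHom_surjective P Q⟩, nonempty_EPIso_iff,
    fun _ => ⟨fun h => h.zeta, .of_zeta⟩⟩
end

section
/- Every quiver whose underlying graph is Euclidean of type Ã_n (a cycle), D̃_n (n ≥ 4), Ẽ_6, Ẽ_7, or Ẽ_8 is representation-infinite over any infinite field k: there exist infinitely many pairwise non-isomorphic indecomposable finite-dimensional representations. -/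
/-! A minimal framework for representations of a quiver with vertex set `V`,
arrow set `E` and source/target maps `s t : E → V`, over a field `k`. -/

structure QRep (k : Type) [Field k] {V E : Type} (s t : E → V) where
  space : V → Type
  [acg : ∀ v, AddCommGroup (space v)]
  [mod : ∀ v, Module k (space v)]
  map : ∀ e : E, space (s e) →ₗ[k] space (t e)

attribute [instance] QRep.acg QRep.mod

namespace QRep

variable {k : Type} [Field k] {V E : Type} {s t : E → V}

/-- An isomorphism of representations: compatible linear equivalences at every vertex. -/
structure Iso (M N : QRep k s t) where
  app : ∀ v, M.space v ≃ₗ[k] N.space v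
  comm : ∀ (e : E) (x : M.space (s e)), app (t e) (M.map e x) = N.map e (app (s e) x)

/-- The (binary) direct sum of two representations. -/
def prod (M N : QRep k s t) : QRep k s t where
  space v := M.space v × N.space v
  acg v := inferInstanceAs (AddCommGroup (M.space v × N.space v))
  mod v := inferInstanceAs (Module k (M.space v × N.space v))
  map e := (M.map e).prodMap (N.map e)

/-- The direct sum of an arbitrary family of representations. -/
noncomputable def dsum {ι : Type} (F : ι → QRep k s t) : QRep k s t :=
  letI := Classical.decEq ι
  { space := fun v => DirectSum ι fun i => (F i).space v
    acg := fun v => inferInstanceAs (AddCommGroup (DirectSum ι fun i => (F i).space v))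
    mod := fun v => inferInstanceAs (Module k (DirectSum ι fun i => (F i).space v))
    map := fun e => DirectSum.toModule k ι (DirectSum ι fun i => (F i).space (t e))
      fun i => (DirectSum.lof k ι (fun j => (F j).space (t e)) i).comp ((F i).map e) }

/-- The zero representation predicate. -/
def IsZero (M : QRep k s t) : Prop := ∀ (v : V) (x : M.space v), x = 0

/-- A representation is indecomposable if it is nonzero and any direct sum
decomposition has a zero summand. -/
def Indecomposable (M : QRep k s t) : Prop :=
  ¬ M.IsZero ∧ ∀ N₁ N₂ : QRep k s t, Nonempty (Iso M (N₁.prod N₂)) → N₁.IsZero ∨ N₂.IsZero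

/-- A representation is thin if all vertex spaces have dimension at most `1`. -/
def Thin (M : QRep k s t) : Prop := ∀ v : V, Module.rank k (M.space v) ≤ 1

/-- All vertex spaces are finite-dimensional. -/
def FinDim (M : QRep k s t) : Prop := ∀ v : V, FiniteDimensional k (M.space v)

end QRep

/-- The representation `M(Q)`: the field `k` at every vertex, identity at every arrow. -/
def constRep (k : Type) [Field k] {V E : Type} (s t : E → V) : QRep k s t where
  space _ := k
  acg _ := inferInstanceAs (AddCommGroup k)
  mod _ := inferInstanceAs (Module k k)
  map _ := LinearMap.id

/-- The canonical map `(PLift P → k) → (PLift Q → k)`: the identity if `P` holds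
(the two spaces both being `k` then), and zero otherwise. -/
noncomputable def restrictMap (k : Type) [Field k] (P Q : Prop) : (PLift P → k) →ₗ[k] (PLift Q → k) :=
  letI := Classical.propDecidable P
  { toFun := fun v _ => if h : P then v ⟨h⟩ else 0
    map_add' := by
      intro a b; funext hq; by_cases hP : P <;> simp [hP]
    map_smul' := by
      intro c a; funext hq; by_cases hP : P <;> simp [hP] }

/-- The thin representation `M(Q')` attached to a set `S` of vertices (full subquiver on `S`):
one-dimensional spaces on `S`, zero outside, identity maps on arrows inside `S`,
zero maps elsewhere. -/
noncomputable def subsetRep (k : Type) [Field k] {V E : Type} (s t : E → V) (S : Set V) : QRep k s t where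
  space v := PLift (v ∈ S) → k
  acg v := inferInstanceAs (AddCommGroup (PLift (v ∈ S) → k))
  mod v := inferInstanceAs (Module k (PLift (v ∈ S) → k))
  map e := restrictMap k (s e ∈ S) (t e ∈ S)

/-- The underlying (simple) graph of a quiver. -/
def underlying {V E : Type} (s t : E → V) : SimpleGraph V :=
  SimpleGraph.fromRel fun a b => ∃ e, s e = a ∧ t e = b

/-- A quiver `(s, t)` has the shape given by an edge-endpoint list `ep` on `n` vertices and
`m` edges: there are bijections of vertices and edges matching each arrow (in one of the two
possible orientations) with the corresponding edge of the list. -/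
def IsShape {V E : Type} (s t : E → V) (n m : ℕ) (ep : Fin m → Fin n × Fin n) : Prop :=
  ∃ (φ : V ≃ Fin n) (ψ : E ≃ Fin m),
    ∀ e : E, (φ (s e), φ (t e)) = ep (ψ e) ∨ (φ (t e), φ (s e)) = ep (ψ e)

/-- Edge list of the Euclidean graph `Ã_n`: a cycle with `n+1` vertices. -/
def epA (n : ℕ) : Fin (n + 1) → Fin (n + 1) × Fin (n + 1) := fun i =>
  (i, ⟨(i.val + 1) % (n + 1), Nat.mod_lt _ (Nat.succ_pos n)⟩)

/-- Edge list of the Euclidean graph `D̃_n` (`n ≥ 4`): `n+1` vertices, a central path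
`2, 3, ..., n-2` with two leaves `0, 1` attached at `2` and two leaves `n-1, n` at `n-2`. -/
def epD (n : ℕ) (hn : 4 ≤ n) : Fin n → Fin (n + 1) × Fin (n + 1) := fun i =>
  if i.val = 0 then (⟨0, by omega⟩, ⟨2, by omega⟩)
  else if i.val = 1 then (⟨1, by omega⟩, ⟨2, by omega⟩)
  else if i.val = n - 1 then (⟨n - 2, by omega⟩, ⟨n, by omega⟩)
  else (⟨i.val, by have := i.isLt; omega⟩, ⟨i.val + 1, by have := i.isLt; omega⟩)

/-- Edge list of the Euclidean graph `Ẽ₆` (arm-length type `(3,3,3)`). -/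
def epE6 : Fin 6 → Fin 7 × Fin 7 := ![(0, 1), (1, 2), (2, 3), (3, 4), (2, 5), (5, 6)]

/-- Edge list of the Euclidean graph `Ẽ₇` (arm-length type `(4,4,2)`). -/
def epE7 : Fin 7 → Fin 8 × Fin 8 :=
  ![(0, 1), (1, 2), (2, 3), (3, 4), (4, 5), (5, 6), (3, 7)]

/-- Edge list of the Euclidean graph `Ẽ₈` (arm-length type `(6,3,2)`). -/
def epE8 : Fin 8 → Fin 9 × Fin 9 :=
  ![(0, 1), (1, 2), (2, 3), (3, 4), (4, 5), (5, 6), (6, 7), (2, 8)]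

namespace QRep

section Bricks

variable {k : Type} [Field k] {V E : Type} {s t : E → V}

/-- A representation has only scalar endomorphisms. -/
def ScalarEnd (M : QRep k s t) : Prop :=
  ∀ g : ∀ v, M.space v →ₗ[k] M.space v,
    (∀ (e : E) (x : M.space (s e)), g (t e) (M.map e x) = M.map e (g (s e) x)) →
    ∃ c : k, ∀ (v : V) (x : M.space v), g v x = c • x

/-- The projection of a direct sum of two representations onto its first summand. -/
def prodProj (N₁ N₂ : QRep k s t) (v : V) : (N₁.prod N₂).space v →ₗ[k] (N₁.prod N₂).space v where
  toFun p := ((p.1, 0) : N₁.space v × N₂.space v)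
  map_add' _ _ := Prod.ext rfl (add_zero (0 : N₂.space v)).symm
  map_smul' c _ := Prod.ext rfl (smul_zero (A := N₂.space v) c).symm

theorem ScalarEnd.indecomposable {M : QRep k s t} (hM : M.ScalarEnd) (h0 : ¬ M.IsZero) :
    M.Indecomposable := by
  refine ⟨h0, ?_⟩
  rintro N₁ N₂ ⟨φ⟩
  obtain ⟨c, hc⟩ := hM
    (fun v => (φ.app v).symm.toLinearMap ∘ₗ prodProj N₁ N₂ v ∘ₗ (φ.app v).toLinearMap) (by
      intro e x
      apply (φ.app (t e)).injective
      simp only [LinearMap.comp_apply, LinearEquiv.coe_coe, LinearEquiv.apply_symm_apply, φ.comm]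
      exact Prod.ext rfl (map_zero (N₂.map e)).symm)
  have key : ∀ (v : V) (p : (N₁.prod N₂).space v), prodProj N₁ N₂ v p = c • p := by
    intro v p
    have := congrArg (φ.app v) (hc v ((φ.app v).symm p))
    simpa using this
  by_cases h : c = 0
  · left
    intro v x
    have := congrArg Prod.fst (key v ((x, 0) : N₁.space v × N₂.space v))
    exact this.trans (by subst h; exact zero_smul k x)
  · right
    intro v x
    have : (0 : N₂.space v) = c • x :=
      congrArg Prod.snd (key v ((0, x) : N₁.space v × N₂.space v))
    exact (smul_eq_zero.1 this.symm).resolve_left h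

theorem exists_infinite_family [Infinite k] (M : k → QRep k s t) (hfd : ∀ a, (M a).FinDim)
    (h0 : ∀ a, ¬ (M a).IsZero) (hend : ∀ a, (M a).ScalarEnd)
    (hiso : ∀ a b, a ≠ b → ¬ Nonempty (Iso (M a) (M b))) :
    ∃ f : ℕ → QRep k s t,
      (∀ j, (f j).FinDim ∧ (f j).Indecomposable) ∧
      (∀ i j, i ≠ j → ¬ Nonempty (QRep.Iso (f i) (f j))) :=
  ⟨fun j => M (Infinite.natEmbedding k j),
    fun _ => ⟨hfd _, (hend _).indecomposable (h0 _)⟩,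
    fun _ _ hij => hiso _ _ fun h => hij ((Infinite.natEmbedding k).injective h)⟩

end Bricks

section Cycle

variable {k : Type} [Field k] {V E : Type}

/-- The representation with the field `k` at every vertex in which the arrow `e` acts as
multiplication by `w e`. -/
def weighted (s t : E → V) (w : E → k) : QRep k s t where
  space _ := k
  acg _ := inferInstanceAs (AddCommGroup k)
  mod _ := inferInstanceAs (Module k k)
  map e := (w e • LinearMap.id : k →ₗ[k] k)

theorem exists_infinite_family_of_cycle [Infinite k] {s t : E → V} {n : ℕ}
    (h : IsShape s t (n + 1) (n + 1) (epA n)) :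
    ∃ f : ℕ → QRep k s t,
      (∀ j, (f j).FinDim ∧ (f j).Indecomposable) ∧
      (∀ i j, i ≠ j → ¬ Nonempty (QRep.Iso (f i) (f j))) := by
  obtain ⟨φ, ψ, h⟩ := h
  set w : k → E → k := fun a e => if ψ e = Fin.last n then a else 1 with hw
  have key : ∀ (a b : k) (g : V → k), (∀ e, g (t e) * w a e = w b e * g (s e)) →
      ∃ c, (∀ v, g v = c) ∧ (a ≠ b → c = 0) := by
    intro a b g hg
    have hstep : ∀ i (hi : i < n + 1), g (φ.symm ⟨i, hi⟩) = g (φ.symm 0) := by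
      intro i
      induction i with
      | zero => intro _; rfl
      | succ i ih =>
        intro hi
        have hne : (⟨i, by omega⟩ : Fin (n + 1)) ≠ Fin.last n := by
          simp only [ne_eq, Fin.ext_iff, Fin.val_last]; omega
        have hge := hg (ψ.symm ⟨i, by omega⟩)
        have he := h (ψ.symm ⟨i, by omega⟩)
        simp only [hw, Equiv.apply_symm_apply, hne, if_false, mul_one, one_mul] at hge
        simp only [Equiv.apply_symm_apply, epA, Prod.mk.injEq, Nat.mod_eq_of_lt hi,
          ← Equiv.eq_symm_apply] at he
        rw [← ih (by omega)]
        rcases he with ⟨h1, h2⟩ | ⟨h1, h2⟩ <;> rw [h1, h2] at hge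
        · exact hge
        · exact hge.symm
    have hall : ∀ v, g v = g (φ.symm 0) := fun v => by
      simpa using hstep (φ v) (φ v).isLt
    refine ⟨_, hall, fun hab => ?_⟩
    have hge := hg (ψ.symm (Fin.last n))
    rw [hall (s _), hall (t _)] at hge
    simp only [hw, Equiv.apply_symm_apply, if_true] at hge
    have : (a - b) * g (φ.symm 0) = 0 := by linear_combination hge
    exact (mul_eq_zero.1 this).resolve_left (sub_ne_zero.2 hab)
  have hom : ∀ (a b : k) (g : V → k →ₗ[k] k),
      (∀ e (x : k), g (t e) (w a e • x) = w b e • g (s e) x) →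
      ∃ c : k, (∀ v x, g v x = c • x) ∧ (a ≠ b → c = 0) := by
    intro a b g hg
    obtain ⟨c, hc, hab⟩ := key a b (fun v => g v 1) fun e => by
      have := hg e 1
      rw [map_smul] at this
      rw [mul_comm]
      exact this
    refine ⟨c, fun v x => ?_, hab⟩
    have := (g v).map_smul x 1
    rw [smul_eq_mul, mul_one] at this
    rw [this, hc, smul_eq_mul, smul_eq_mul, mul_comm]
  refine exists_infinite_family (fun a => weighted s t (w a))
    (fun a v => inferInstanceAs (FiniteDimensional k k))
    (fun a h0 => one_ne_zero (α := k) (h0 (φ.symm 0) (1 : k))) ?_ ?_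
  · intro a g hg
    obtain ⟨c, hc, -⟩ := hom a a g hg
    exact ⟨c, hc⟩
  · rintro a b hab ⟨g⟩
    obtain ⟨c, hc, h0⟩ := hom a b (fun v => (g.app v).toLinearMap) g.comm
    have h1 : g.app (φ.symm 0) (1 : k) = 0 := (hc (φ.symm 0) 1).trans (by
      rw [h0 hab]; exact zero_smul k _)
    exact one_ne_zero (α := k) ((g.app (φ.symm 0)).map_eq_zero_iff.1 h1)

end Cycle

section Subquotients

variable {k : Type} [Field k] {V E W : Type} [AddCommGroup W] [Module k W] {s t : E → V}

/-- The representation formed by subquotients `A v / B v` of a fixed space, all arrows acting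
as the maps induced by the identity. -/
def subquot (s t : E → V) (A B : V → Submodule k W) (hA : ∀ e, A (s e) ≤ A (t e))
    (hB : ∀ e, B (s e) ≤ B (t e)) : QRep k s t where
  space v := A v ⧸ (B v).submoduleOf (A v)
  acg v := inferInstanceAs (AddCommGroup (A v ⧸ (B v).submoduleOf (A v)))
  mod v := inferInstanceAs (Module k (A v ⧸ (B v).submoduleOf (A v)))
  map e := Submodule.mapQ ((B (s e)).submoduleOf (A (s e))) ((B (t e)).submoduleOf (A (t e)))
    (Submodule.inclusion (hA e)) fun _ hx => hB e hx

/-- A homomorphism between subquotient representations of the same space `W` is induced by a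
linear endomorphism of `W`, provided every vertex can be reached from a root carrying `W` by
inclusions of subspaces and projections onto quotients. -/
theorem exists_inducing_map {A B A' B' : V → Submodule k W}
    (hA : ∀ e, A (s e) ≤ A (t e)) (hA' : ∀ e, A' (s e) ≤ A' (t e))
    (hBA' : ∀ v, B' v ≤ A' v) (c : V) (hAc : A c = ⊤) (hBc' : B' c = ⊥)
    (r : V → ℕ)
    (hr : ∀ v, v = c ∨ ∃ e,
      (t e = v ∧ r (s e) < r v ∧ A v = A (s e)) ∨
      (s e = v ∧ r (t e) < r v ∧ B' v = B' (t e)))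
    (g : ∀ v, (A v ⧸ (B v).submoduleOf (A v)) →ₗ[k] (A' v ⧸ (B' v).submoduleOf (A' v)))
    (hg : ∀ e (x : W) (hx : x ∈ A (s e)) (y : W) (hy : y ∈ A' (s e)),
      g (s e) (Submodule.Quotient.mk ⟨x, hx⟩) = Submodule.Quotient.mk ⟨y, hy⟩ →
      g (t e) (Submodule.Quotient.mk ⟨x, hA e hx⟩) = Submodule.Quotient.mk ⟨y, hA' e hy⟩) :
    ∃ f : W →ₗ[k] W, ∀ v x (hx : x ∈ A v), ∃ hy : f x ∈ A' v,
      g v (Submodule.Quotient.mk ⟨x, hx⟩) = Submodule.Quotient.mk ⟨f x, hy⟩ := by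
  have hbot : (B' c).submoduleOf (A' c) = ⊥ := by
    rw [hBc', Submodule.submoduleOf, Submodule.comap_bot, Submodule.ker_subtype]
  have hmem : ∀ x, LinearMap.id (R := k) (M := W) x ∈ A c := fun x => hAc ▸ Submodule.mem_top
  refine ⟨(A' c).subtype ∘ₗ ((B' c).submoduleOf (A' c)).quotEquivOfEqBot hbot ∘ₗ g c ∘ₗ
    Submodule.mkQ _ ∘ₗ LinearMap.codRestrict (A c) LinearMap.id hmem, ?_⟩
  set f := (A' c).subtype ∘ₗ (((B' c).submoduleOf (A' c)).quotEquivOfEqBot hbot).toLinearMap ∘ₗ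
    g c ∘ₗ Submodule.mkQ _ ∘ₗ LinearMap.codRestrict (A c) LinearMap.id hmem with hf
  suffices H : ∀ n v, r v = n → ∀ x (hx : x ∈ A v), ∃ hy : f x ∈ A' v,
      g v (Submodule.Quotient.mk ⟨x, hx⟩) = Submodule.Quotient.mk ⟨f x, hy⟩ from
    fun v => H _ v rfl
  intro n
  induction n using Nat.strong_induction_on with
  | _ n ih =>
  intro v hv x hx
  rcases hr v with rfl | ⟨e, ⟨rfl, hlt, hAe⟩ | ⟨rfl, hlt, hBe⟩⟩
  · refine ⟨Subtype.prop _, ?_⟩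
    exact (((B' v).submoduleOf (A' v)).quotEquivOfEqBot hbot).symm_apply_apply _ |>.symm
  · have hx' : x ∈ A (s e) := hAe ▸ hx
    obtain ⟨hy, h⟩ := ih _ (hv ▸ hlt) (s e) rfl x hx'
    exact ⟨hA' e hy, hg e x hx' _ hy h⟩
  · obtain ⟨hy, h⟩ := ih _ (hv ▸ hlt) (t e) rfl x (hA e hx)
    obtain ⟨⟨y, hys⟩, hyx⟩ := Submodule.Quotient.mk_surjective _
      (g (s e) (Submodule.Quotient.mk ⟨x, hx⟩))
    have h1 := hg e x hx y hys hyx.symm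
    rw [h, Submodule.Quotient.eq] at h1
    have h2 : f x - y ∈ B' (s e) := hBe ▸ h1
    have h3 : f x ∈ A' (s e) := by simpa using add_mem (hBA' _ h2) hys
    refine ⟨h3, ?_⟩
    rw [← hyx, eq_comm, Submodule.Quotient.eq]
    exact h2

end Subquotients

section Stars

/-- The data exhibiting a tree quiver as a centre (a subtree of vertices of depth `0`) with
arms attached to it: the arm `a` consists of vertices of depths `1, …, m a - 1`, and every arrow
joins a child to its parent, in either direction. -/
structure StarShape {V E ι : Type} (s t : E → V) (m : ι → ℕ) where
  root : V
  arm : V → ι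
  dep : V → ℕ
  rank : V → ℕ
  par : E → V
  ch : E → V
  ends : ∀ e, (s e = ch e ∧ t e = par e) ∨ (s e = par e ∧ t e = ch e)
  dep_root : dep root = 0
  rank_lt : ∀ e, rank (par e) < rank (ch e)
  eq_root_or : ∀ v, v = root ∨ ∃ e, ch e = v
  ch_inj : ∀ e e', ch e = ch e' → e = e'
  step : ∀ e, (dep (par e) = 0 ∧ dep (ch e) = 0) ∨
    (dep (ch e) = dep (par e) + 1 ∧ (dep (par e) = 0 ∨ arm (par e) = arm (ch e)))
  dep_lt : ∀ v, dep v < m (arm v)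
  arm_dep_inj : ∀ v v', dep v ≠ 0 → dep v = dep v' → arm v = arm v' → v = v'
  cover : ∀ a j, 0 < j → j < m a → ∃ v, arm v = a ∧ dep v = j

namespace StarShape

/-- The star structure of a graph is independent of the orientation of its edges. -/
def ofIsShape {V E ι : Type} {s t : E → V} {m : ι → ℕ} {p q : ℕ} {ep : Fin q → Fin p × Fin p}
    (S : StarShape (fun i => (ep i).1) (fun i => (ep i).2) m) (φ : V ≃ Fin p) (ψ : E ≃ Fin q)
    (h : ∀ e : E, (φ (s e), φ (t e)) = ep (ψ e) ∨ (φ (t e), φ (s e)) = ep (ψ e)) :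
    StarShape s t m where
  root := φ.symm S.root
  arm v := S.arm (φ v)
  dep v := S.dep (φ v)
  rank v := S.rank (φ v)
  par e := φ.symm (S.par (ψ e))
  ch e := φ.symm (S.ch (ψ e))
  ends e := by
    have h1 := S.ends (ψ e)
    simp only [Equiv.eq_symm_apply]
    rcases h e with h2 | h2
    · rw [← h2] at h1
      exact h1
    · rw [← h2] at h1
      exact h1.symm.imp And.symm And.symm
  dep_root := by simpa using S.dep_root
  rank_lt e := by simpa using S.rank_lt (ψ e)
  eq_root_or v := by
    rcases S.eq_root_or (φ v) with h1 | ⟨i, hi⟩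
    · exact Or.inl (by rw [← h1, Equiv.symm_apply_apply])
    · exact Or.inr ⟨ψ.symm i, by rw [Equiv.apply_symm_apply, hi, Equiv.symm_apply_apply]⟩
  ch_inj e e' h1 := ψ.injective (S.ch_inj _ _ (φ.symm.injective h1))
  step e := by simpa using S.step (ψ e)
  dep_lt v := S.dep_lt (φ v)
  arm_dep_inj v v' h1 h2 h3 := φ.injective (S.arm_dep_inj _ _ h1 h2 h3)
  cover a j h1 h2 := by
    obtain ⟨v, hv⟩ := S.cover a j h1 h2
    exact ⟨φ.symm v, by simpa using hv⟩

variable {k : Type} [Field k] {V E W ι : Type} [AddCommGroup W] [Module k W] {s t : E → V}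
  {m : ι → ℕ}

/-- The edge of the arm `a` between the depths `j` and `j + 1` points towards the centre. -/
def Inward (S : StarShape s t m) (a : ι) (j : ℕ) : Prop :=
  ∃ e, S.arm (S.ch e) = a ∧ S.dep (S.ch e) = j + 1 ∧ s e = S.ch e

open Classical in
/-- The index of the larger subspace of the flag at depth `j` of the arm `a`. -/
noncomputable def hi (S : StarShape s t m) (a : ι) (j : ℕ) : ℕ := m a - Nat.count (S.Inward a) j

open Classical in
/-- The index of the smaller subspace of the flag at depth `j` of the arm `a`. -/
noncomputable def lo (S : StarShape s t m) (a : ι) (j : ℕ) : ℕ :=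
  Nat.count (fun i => ¬ S.Inward a i) j

@[simp] theorem hi_zero (S : StarShape s t m) (a : ι) : S.hi a 0 = m a := by simp [hi]

@[simp] theorem lo_zero (S : StarShape s t m) (a : ι) : S.lo a 0 = 0 := by simp [lo]

theorem lo_add_count (S : StarShape s t m) (a : ι) (j : ℕ) :
    S.lo a j + (m a - S.hi a j) = j ∨ m a < j := by
  classical
  have h : ∀ j, S.lo a j + Nat.count (S.Inward a) j = j := by
    intro j
    induction j with
    | zero => simp
    | succ j ih =>
      simp only [lo, Nat.count_succ] at ih ⊢
      split_ifs <;> omega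
  have := h j
  simp only [hi]
  omega

theorem lo_le_hi (S : StarShape s t m) (v : V) :
    S.lo (S.arm v) (S.dep v) ≤ S.hi (S.arm v) (S.dep v) := by
  have h1 := S.dep_lt v
  have h2 := S.lo_add_count (S.arm v) (S.dep v)
  omega

theorem succ_of_inward (S : StarShape s t m) {a : ι} {j : ℕ} (h : S.Inward a j) :
    S.hi a (j + 1) = S.hi a j - 1 ∧ S.lo a (j + 1) = S.lo a j := by
  simp [hi, lo, Nat.count_succ, h, Nat.sub_sub]

theorem succ_of_not_inward (S : StarShape s t m) {a : ι} {j : ℕ} (h : ¬ S.Inward a j) :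
    S.hi a (j + 1) = S.hi a j ∧ S.lo a (j + 1) = S.lo a j + 1 := by
  simp [hi, lo, Nat.count_succ, h]

/-- Every index up to `m a` occurs among the indices `hi a j` and `lo a j`. -/
theorem forall_of_hi_lo (S : StarShape s t m) (a : ι) (P : ℕ → Prop)
    (h : ∀ j, j < m a → P (S.hi a j) ∧ P (S.lo a j)) (i : ℕ) (h0 : 0 < i) (hi : i < m a) : P i := by
  have key : ∀ j, j < m a → (∀ i, i ≤ S.lo a j → P i) ∧ ∀ i, S.hi a j ≤ i → i ≤ m a → P i := by
    intro j
    induction j with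
    | zero =>
      intro hj
      have := h 0 hj
      simp only [hi_zero, lo_zero] at this ⊢
      refine ⟨fun i hi => ?_, fun i h1 h2 => ?_⟩
      · rw [Nat.le_zero.1 hi]; exact this.2
      · rw [le_antisymm h2 h1]; exact this.1
    | succ j ih =>
      intro hj
      obtain ⟨h1, h2⟩ := ih (by omega)
      obtain ⟨h3, h4⟩ := h (j + 1) hj
      by_cases hin : S.Inward a j
      · obtain ⟨h5, h6⟩ := S.succ_of_inward hin
        rw [h5] at h3 ⊢
        rw [h6]
        refine ⟨h1, fun i hi hm => ?_⟩
        rcases hi.eq_or_lt with rfl | hlt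
        · exact h3
        · exact h2 i (by omega) hm
      · obtain ⟨h5, h6⟩ := S.succ_of_not_inward hin
        rw [h6] at h4 ⊢
        rw [h5]
        refine ⟨fun i hi => ?_, h2⟩
        rcases hi.eq_or_lt with rfl | hlt
        · exact h4
        · exact h1 i (by omega)
  obtain ⟨h1, h2⟩ := key (m a - 1) (by omega)
  have h3 := S.lo_add_count a (m a - 1)
  by_cases h4 : i ≤ S.lo a (m a - 1)
  · exact h1 i h4
  · exact h2 i (by omega) hi.le

section Flags

variable (S : StarShape s t m) (F : ι → ℕ → Submodule k W)

/-- The larger subspace attached to a vertex by a family of flags. -/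
noncomputable def upper (v : V) : Submodule k W := F (S.arm v) (S.hi (S.arm v) (S.dep v))

/-- The smaller subspace attached to a vertex by a family of flags. -/
noncomputable def lower (v : V) : Submodule k W := F (S.arm v) (S.lo (S.arm v) (S.dep v))

variable {F}

theorem upper_of_dep_eq_zero (hm : ∀ a, F a (m a) = ⊤) {v : V} (hv : S.dep v = 0) :
    S.upper F v = ⊤ := by
  rw [upper, hv, hi_zero, hm]

theorem lower_of_dep_eq_zero (h0 : ∀ a, F a 0 = ⊥) {v : V} (hv : S.dep v = 0) :
    S.lower F v = ⊥ := by
  rw [lower, hv, lo_zero, h0]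

theorem lower_le_upper (hF : ∀ a, Monotone (F a)) (v : V) : S.lower F v ≤ S.upper F v :=
  hF _ (S.lo_le_hi v)

theorem upper_lower_of_source (hF : ∀ a, Monotone (F a)) (h0 : ∀ a, F a 0 = ⊥)
    (hm : ∀ a, F a (m a) = ⊤) {e : E} (he : s e = S.ch e) :
    S.upper F (S.ch e) ≤ S.upper F (S.par e) ∧ S.lower F (S.ch e) = S.lower F (S.par e) := by
  rcases S.step e with ⟨h1, h2⟩ | ⟨h1, h2⟩
  · rw [S.upper_of_dep_eq_zero hm h1, S.lower_of_dep_eq_zero h0 h1, S.lower_of_dep_eq_zero h0 h2]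
    exact ⟨le_top, rfl⟩
  · obtain ⟨h3, h4⟩ := S.succ_of_inward ⟨e, rfl, h1, he⟩
    rcases h2 with h2 | h2
    · rw [S.upper_of_dep_eq_zero hm h2, S.lower_of_dep_eq_zero h0 h2, lower, h1, h4, h2, lo_zero,
        h0]
      exact ⟨le_top, rfl⟩
    · simp only [upper, lower, h1, h2, h3, h4, and_true]
      exact hF _ (Nat.sub_le _ _)

theorem upper_lower_of_target (hF : ∀ a, Monotone (F a)) (h0 : ∀ a, F a 0 = ⊥)
    (hm : ∀ a, F a (m a) = ⊤) {e : E} (he : s e = S.par e) :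
    S.upper F (S.ch e) = S.upper F (S.par e) ∧ S.lower F (S.par e) ≤ S.lower F (S.ch e) := by
  rcases S.step e with ⟨h1, h2⟩ | ⟨h1, h2⟩
  · rw [S.upper_of_dep_eq_zero hm h1, S.upper_of_dep_eq_zero hm h2, S.lower_of_dep_eq_zero h0 h1]
    exact ⟨rfl, bot_le⟩
  · have hin : ¬ S.Inward (S.arm (S.ch e)) (S.dep (S.par e)) := by
      rintro ⟨e', h3, h4, h5⟩
      obtain rfl := S.ch_inj _ _ (S.arm_dep_inj _ (S.ch e) (by omega) (h4.trans h1.symm) h3)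
      exact (S.rank_lt e').ne (congrArg S.rank (he.symm.trans h5))
    obtain ⟨h3, h4⟩ := S.succ_of_not_inward hin
    rcases h2 with h2 | h2
    · rw [S.upper_of_dep_eq_zero hm h2, S.lower_of_dep_eq_zero h0 h2, upper, h1, h3, h2, hi_zero,
        hm]
      exact ⟨rfl, bot_le⟩
    · simp only [upper, lower, h1, h2, h3, h4, true_and]
      exact hF _ (Nat.le_succ _)

theorem upper_mono (hF : ∀ a, Monotone (F a)) (h0 : ∀ a, F a 0 = ⊥)
    (hm : ∀ a, F a (m a) = ⊤) (e : E) : S.upper F (s e) ≤ S.upper F (t e) := by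
  rcases S.ends e with ⟨h1, h2⟩ | ⟨h1, h2⟩
  · rw [h2, h1]; exact (S.upper_lower_of_source hF h0 hm h1).1
  · rw [h2, h1]; exact (S.upper_lower_of_target hF h0 hm h1).1.ge

theorem lower_mono (hF : ∀ a, Monotone (F a)) (h0 : ∀ a, F a 0 = ⊥)
    (hm : ∀ a, F a (m a) = ⊤) (e : E) : S.lower F (s e) ≤ S.lower F (t e) := by
  rcases S.ends e with ⟨h1, h2⟩ | ⟨h1, h2⟩
  · rw [h2, h1]; exact (S.upper_lower_of_source hF h0 hm h1).2.le
  · rw [h2, h1]; exact (S.upper_lower_of_target hF h0 hm h1).2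

/-- A linear map respecting all subspaces `upper` and `lower` respects the flags. -/
theorem mem_flag_of_mem_flag {F' : ι → ℕ → Submodule k W} (h0 : ∀ a, F a 0 = ⊥)
    (hm' : ∀ a, F' a (m a) = ⊤) (f : W →ₗ[k] W)
    (hA : ∀ v, ∀ x ∈ S.upper F v, f x ∈ S.upper F' v)
    (hB : ∀ v, ∀ x ∈ S.lower F v, f x ∈ S.lower F' v)
    (a : ι) (i : ℕ) (hi0 : 0 < i) (him : i < m a) : ∀ x ∈ F a i, f x ∈ F' a i := by
  refine S.forall_of_hi_lo a (fun i => ∀ x ∈ F a i, f x ∈ F' a i) (fun j hj => ?_) i hi0 him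
  rcases Nat.eq_zero_or_pos j with rfl | hj0
  · rw [hi_zero, lo_zero, hm', h0]
    refine ⟨fun x _ => Submodule.mem_top, fun x hx => ?_⟩
    rw [(Submodule.mem_bot k).1 hx, map_zero]
    exact zero_mem _
  · obtain ⟨v, rfl, rfl⟩ := S.cover a j hj0 hj
    exact ⟨hA v, hB v⟩

end Flags

/-- A one-parameter family of configurations of flags, rigid in the sense that only scalars
preserve each of them and no nonzero map transforms one into another, gives infinitely many
indecomposable representations of the corresponding star. -/
theorem exists_infinite_family [Infinite k] [FiniteDimensional k W] [Nontrivial W]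
    (S : StarShape s t m) (F : k → ι → ℕ → Submodule k W) (hF : ∀ l a, Monotone (F l a))
    (h0 : ∀ l a, F l a 0 = ⊥) (hm : ∀ l a, F l a (m a) = ⊤)
    (hrigid : ∀ (l l' : k) (f : W →ₗ[k] W),
      (∀ a i, 0 < i → i < m a → ∀ x ∈ F l a i, f x ∈ F l' a i) →
      ∃ c : k, (∀ x, f x = c • x) ∧ (l ≠ l' → c = 0)) :
    ∃ f : ℕ → QRep k s t,
      (∀ j, (f j).FinDim ∧ (f j).Indecomposable) ∧
      (∀ i j, i ≠ j → ¬ Nonempty (QRep.Iso (f i) (f j))) := by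
  set M : k → QRep k s t := fun l => subquot s t (S.upper (F l)) (S.lower (F l))
    (S.upper_mono (hF l) (h0 l) (hm l)) (S.lower_mono (hF l) (h0 l) (hm l))
  have hom : ∀ (l l' : k) (g : ∀ v, (M l).space v →ₗ[k] (M l').space v),
      (∀ (e : E) (x : (M l).space (s e)), g (t e) ((M l).map e x) = (M l').map e (g (s e) x)) →
      ∃ c : k, (∀ v (x : S.upper (F l) v), ∃ hx : c • (x : W) ∈ S.upper (F l') v,
        g v (Submodule.Quotient.mk x) =
          (Submodule.Quotient.mk ⟨c • (x : W), hx⟩ : _ ⧸ (S.lower (F l') v).submoduleOf _)) ∧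
        (l ≠ l' → c = 0) := by
    intro l l' g hg
    obtain ⟨f, hf⟩ := exists_inducing_map (B := S.lower (F l))
      (S.upper_mono (hF l) (h0 l) (hm l)) (S.upper_mono (hF l') (h0 l') (hm l'))
      (S.lower_le_upper (hF l')) S.root (S.upper_of_dep_eq_zero (hm l) S.dep_root)
      (S.lower_of_dep_eq_zero (h0 l') S.dep_root) S.rank (by
        intro v
        refine (S.eq_root_or v).imp_right ?_
        rintro ⟨e, rfl⟩
        refine ⟨e, ?_⟩
        rcases S.ends e with ⟨h1, h2⟩ | ⟨h1, h2⟩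
        · rw [h1, h2]
          exact Or.inr ⟨rfl, S.rank_lt e, (S.upper_lower_of_source (hF l') (h0 l') (hm l') h1).2⟩
        · rw [h1, h2]
          exact Or.inl ⟨rfl, S.rank_lt e, (S.upper_lower_of_target (hF l) (h0 l) (hm l) h1).1⟩)
      g (by
        intro e x hx y hy hxy
        exact (hg e (Submodule.Quotient.mk ⟨x, hx⟩)).trans (congrArg ((M l').map e) hxy))
    obtain ⟨c, hc, hll⟩ := hrigid l l' f (S.mem_flag_of_mem_flag (h0 l) (hm l') f
      (fun v x hx => (hf v x hx).1) (fun v x hx => by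
        obtain ⟨hy, h⟩ := hf v x (S.lower_le_upper (hF l) v hx)
        have hz : (Submodule.Quotient.mk ⟨x, S.lower_le_upper (hF l) v hx⟩ :
            _ ⧸ (S.lower (F l) v).submoduleOf (S.upper (F l) v)) = 0 :=
          (Submodule.Quotient.mk_eq_zero _).2 hx
        exact (Submodule.Quotient.mk_eq_zero ((S.lower (F l') v).submoduleOf _)).1
          (h.symm.trans ((congrArg (g v) hz).trans (map_zero (g v))))))
    refine ⟨c, fun v x => ?_, hll⟩
    have := hf v x x.2
    simp only [hc] at this
    exact this
  have hne : ∀ l, ¬ (M l).IsZero := by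
    intro l hz
    obtain ⟨x, hx⟩ := exists_ne (0 : W)
    have hx' : x ∈ S.upper (F l) S.root :=
      S.upper_of_dep_eq_zero (hm l) S.dep_root ▸ Submodule.mem_top
    have h1 : x ∈ S.lower (F l) S.root :=
      (Submodule.Quotient.mk_eq_zero ((S.lower (F l) S.root).submoduleOf _)).1
        (hz S.root (Submodule.Quotient.mk ⟨x, hx'⟩))
    rw [S.lower_of_dep_eq_zero (h0 l) S.dep_root] at h1
    exact hx h1
  refine QRep.exists_infinite_family M (fun l v => Module.Finite.quotient k
    ((S.lower (F l) v).submoduleOf (S.upper (F l) v)))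
    hne ?_ ?_
  · intro l g hg
    obtain ⟨c, hc, -⟩ := hom l l g hg
    refine ⟨c, fun v x => ?_⟩
    obtain ⟨x, rfl⟩ := Submodule.Quotient.mk_surjective _ x
    exact (hc v x).2
  · rintro l l' hll ⟨g⟩
    obtain ⟨c, hc, hc0⟩ := hom l l' (fun v => (g.app v).toLinearMap) g.comm
    refine hne l fun v x => ?_
    obtain ⟨x, rfl⟩ := Submodule.Quotient.mk_surjective _ x
    apply (g.app v).map_eq_zero_iff.1
    refine (hc v x).2.trans ((Submodule.Quotient.mk_eq_zero _).2 ?_)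
    simp only [hc0 hll, zero_smul]
    exact zero_mem (S.lower (F l') v)

end StarShape

end Stars

section Flags

variable {k : Type} [Field k] {d : ℕ}

/-- The flag of coordinate subspaces of `k ^ d` in which the `j`-th coordinate vector belongs to
the `i`-th subspace when `q j < i`. -/
def coordFlag (k : Type) [Field k] (q : Fin d → ℕ) (i : ℕ) : Submodule k (Fin d → k) where
  carrier := {x | ∀ j, i ≤ q j → x j = 0}
  add_mem' hx hy j hj := by simp [hx j hj, hy j hj]
  zero_mem' j _ := rfl
  smul_mem' c x hx j hj := by simp [hx j hj]

theorem coordFlag_mono (q : Fin d → ℕ) : Monotone (coordFlag k q) :=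
  fun _ _ h _ hx j hj => hx j (h.trans hj)

theorem coordFlag_zero (q : Fin d → ℕ) : coordFlag k q 0 = ⊥ :=
  eq_bot_iff.2 fun _ hx => (Submodule.mem_bot k).2 (funext fun j => hx j (Nat.zero_le _))

theorem coordFlag_eq_top {q : Fin d → ℕ} {m : ℕ} (hq : ∀ j, q j < m) : coordFlag k q m = ⊤ :=
  eq_top_iff.2 fun _ _ j hj => absurd (hq j) hj.not_gt

theorem apply_single_eq_zero {q : Fin d → ℕ} {m : ℕ} (hq : ∀ j, q j < m)
    {f : (Fin d → k) →ₗ[k] (Fin d → k)}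
    (hf : ∀ i, 0 < i → i < m → ∀ x ∈ coordFlag k q i, f x ∈ coordFlag k q i) {i j : Fin d}
    (hij : q j < q i) : f (Pi.single j 1) i = 0 := by
  refine hf (q j + 1) (Nat.succ_pos _) (lt_of_le_of_lt hij (hq i)) _ (fun l hl => ?_) i hij
  rw [Pi.single_apply, if_neg]
  rintro rfl
  omega

theorem apply_eq_sum (f : (Fin d → k) →ₗ[k] (Fin d → k)) (x : Fin d → k) (i : Fin d) :
    f x i = ∑ j, x j * f (Pi.single j 1) i := by
  have h : ∀ j : Fin d, (fun l => if j = l then (1 : k) else 0) = Pi.single j 1 := by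
    intro j
    ext l
    simp only [Pi.single_apply, eq_comm]
  rw [LinearMap.pi_apply_eq_sum_univ f x, Finset.sum_apply]
  simp only [h, Pi.smul_apply, smul_eq_mul]

theorem exists_diagonal {f : (Fin d → k) →ₗ[k] (Fin d → k)}
    (hf : ∀ i j, i ≠ j → f (Pi.single j 1) i = 0) : ∃ a : Fin d → k, ∀ x i, f x i = a i * x i := by
  refine ⟨fun i => f (Pi.single i 1) i, fun x i => ?_⟩
  rw [apply_eq_sum, Finset.sum_eq_single i (fun j _ hj => by rw [hf i j hj.symm, mul_zero])
    (by simp), mul_comm]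

/-- The chain of subspaces `0 ≤ L ≤ P ≤ k ^ d`. -/
def shortFlag {W : Type} [AddCommGroup W] [Module k W] (L P : Submodule k W) :
    ℕ → Submodule k W
  | 0 => ⊥
  | 1 => L
  | 2 => P
  | _ => ⊤

theorem shortFlag_mono {W : Type} [AddCommGroup W] [Module k W] {L P : Submodule k W}
    (h : L ≤ P) : Monotone (shortFlag L P) := by
  refine monotone_nat_of_le_succ fun n => ?_
  match n with
  | 0 => exact bot_le
  | 1 => exact h
  | 2 => exact le_top
  | _ + 3 => exact le_top

/-- The line in `k ^ 2` consisting of the vectors annihilated by `a`. -/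
def lineD (a : Fin 2 → k) : Submodule k (Fin 2 → k) where
  carrier := {x | a 0 * x 0 + a 1 * x 1 = 0}
  add_mem' {x y} hx hy := by
    simp only [Set.mem_ofPred_eq, Pi.add_apply] at *
    linear_combination hx + hy
  zero_mem' := by simp
  smul_mem' c x hx := by
    simp only [Set.mem_ofPred_eq, Pi.smul_apply, smul_eq_mul] at *
    linear_combination c * hx

theorem mem_lineD {a x : Fin 2 → k} : x ∈ lineD a ↔ a 0 * x 0 + a 1 * x 1 = 0 := Iff.rfl

/-- The plane of vectors with vanishing coordinate sum. -/
def planeE6 (k : Type) [Field k] : Submodule k (Fin 3 → k) where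
  carrier := {x | x 0 + x 1 + x 2 = 0}
  add_mem' {x y} hx hy := by
    simp only [Set.mem_ofPred_eq, Pi.add_apply] at *
    linear_combination hx + hy
  zero_mem' := by simp
  smul_mem' c x hx := by
    simp only [Set.mem_ofPred_eq, Pi.smul_apply, smul_eq_mul] at *
    linear_combination c * hx

theorem mem_planeE6 {x : Fin 3 → k} : x ∈ planeE6 k ↔ x 0 + x 1 + x 2 = 0 := Iff.rfl

/-- A pencil of lines in `planeE6`. -/
def lineE6 (l : k) : Submodule k (Fin 3 → k) where
  carrier := {x | x 1 = (l - 1) * x 0 ∧ x 2 = -l * x 0}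
  add_mem' {x y} hx hy := by
    simp only [Set.mem_ofPred_eq, Pi.add_apply] at *
    exact ⟨by linear_combination hx.1 + hy.1, by linear_combination hx.2 + hy.2⟩
  zero_mem' := by simp
  smul_mem' c x hx := by
    simp only [Set.mem_ofPred_eq, Pi.smul_apply, smul_eq_mul] at *
    exact ⟨by linear_combination c * hx.1, by linear_combination c * hx.2⟩

theorem mem_lineE6 {l : k} {x : Fin 3 → k} :
    x ∈ lineE6 l ↔ x 1 = (l - 1) * x 0 ∧ x 2 = -l * x 0 := Iff.rfl

/-- A one-parameter family of planes in `k ^ 4`, in general position to two opposite flags. -/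
def planeE7 (l : k) : Submodule k (Fin 4 → k) where
  carrier := {x | x 2 = x 0 + x 1 ∧ x 3 = x 0 + l * x 1}
  add_mem' {x y} hx hy := by
    simp only [Set.mem_ofPred_eq, Pi.add_apply] at *
    exact ⟨by linear_combination hx.1 + hy.1, by linear_combination hx.2 + hy.2⟩
  zero_mem' := by simp
  smul_mem' c x hx := by
    simp only [Set.mem_ofPred_eq, Pi.smul_apply, smul_eq_mul] at *
    exact ⟨by linear_combination c * hx.1, by linear_combination c * hx.2⟩

theorem mem_planeE7 {l : k} {x : Fin 4 → k} :
    x ∈ planeE7 l ↔ x 2 = x 0 + x 1 ∧ x 3 = x 0 + l * x 1 := Iff.rfl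

/-- A one-parameter family of three-dimensional subspaces of `k ^ 6`. -/
def spaceE8 (l : k) : Submodule k (Fin 6 → k) where
  carrier := {x | x 0 = x 3 + x 5 ∧ x 2 = x 1 + l * x 5 ∧ x 4 = x 1 + x 3}
  add_mem' {x y} hx hy := by
    simp only [Set.mem_ofPred_eq, Pi.add_apply] at *
    exact ⟨by linear_combination hx.1 + hy.1, by linear_combination hx.2.1 + hy.2.1,
      by linear_combination hx.2.2 + hy.2.2⟩
  zero_mem' := by simp
  smul_mem' c x hx := by
    simp only [Set.mem_ofPred_eq, Pi.smul_apply, smul_eq_mul] at *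
    exact ⟨by linear_combination c * hx.1, by linear_combination c * hx.2.1,
      by linear_combination c * hx.2.2⟩

theorem mem_spaceE8 {l : k} {x : Fin 6 → k} :
    x ∈ spaceE8 l ↔ x 0 = x 3 + x 5 ∧ x 2 = x 1 + l * x 5 ∧ x 4 = x 1 + x 3 := Iff.rfl

theorem eq_zero_of_mul_eq {l l' c : k} (h : c * l = c * l') (hl : l ≠ l') : c = 0 := by
  have : (l - l') * c = 0 := by linear_combination h
  exact (mul_eq_zero.1 this).resolve_left (sub_ne_zero.2 hl)

theorem rigid_lineD {l l' : k} {f : (Fin 2 → k) →ₗ[k] (Fin 2 → k)}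
    (h0 : ∀ x ∈ lineD (k := k) ![0, 1], f x ∈ lineD (k := k) ![0, 1])
    (h1 : ∀ x ∈ lineD (k := k) ![1, 0], f x ∈ lineD (k := k) ![1, 0])
    (h2 : ∀ x ∈ lineD (k := k) ![1, -1], f x ∈ lineD (k := k) ![1, -1])
    (h3 : ∀ x ∈ lineD ![l, -1], f x ∈ lineD ![l', -1]) :
    ∃ c : k, (∀ x, f x = c • x) ∧ (l ≠ l' → c = 0) := by
  obtain ⟨a, hf⟩ : ∃ a : Fin 2 → Fin 2 → k, ∀ x i, f x i = a i 0 * x 0 + a i 1 * x 1 :=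
    ⟨fun i j => f (Pi.single j 1) i, fun x i => by
      rw [apply_eq_sum, Fin.sum_univ_two, mul_comm, mul_comm (x 1)]⟩
  have e0 := h0 ![1, 0] (by simp [mem_lineD])
  have e1 := h1 ![0, 1] (by simp [mem_lineD])
  have e2 := h2 ![1, 1] (by simp [mem_lineD])
  have e3 := h3 ![1, l] (by simp [mem_lineD])
  simp [mem_lineD, hf] at e0 e1 e2 e3
  refine ⟨a 0 0, fun x => ?_, fun hl => eq_zero_of_mul_eq (l := l) (l' := l') ?_ hl⟩
  · ext i
    fin_cases i <;> simp [hf] <;> grind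
  · grind

theorem rigid_E6 {l l' : k} {f : (Fin 3 → k) →ₗ[k] (Fin 3 → k)}
    (hdiag : ∀ i j, i ≠ j → f (Pi.single j 1) i = 0)
    (hL : ∀ x ∈ lineE6 l, f x ∈ lineE6 l')
    (hP : ∀ x ∈ planeE6 k, f x ∈ planeE6 k) :
    ∃ c : k, (∀ x, f x = c • x) ∧ (l ≠ l' → c = 0) := by
  obtain ⟨a, hf⟩ := exists_diagonal hdiag
  have e0 := hP ![1, -1, 0] (by simp [mem_planeE6])
  have e1 := hP ![0, 1, -1] (by simp [mem_planeE6])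
  have e2 := hL ![1, l - 1, -l] (by simp [mem_lineE6])
  simp [mem_planeE6, mem_lineE6, hf] at e0 e1 e2
  refine ⟨a 0, fun x => ?_, fun hl => eq_zero_of_mul_eq (l := l) (l' := l') ?_ hl⟩
  · ext i
    fin_cases i <;> simp [hf] <;> grind
  · grind

theorem rigid_E7 {l l' : k} {f : (Fin 4 → k) →ₗ[k] (Fin 4 → k)}
    (hdiag : ∀ i j, i ≠ j → f (Pi.single j 1) i = 0)
    (hP : ∀ x ∈ planeE7 l, f x ∈ planeE7 l') :
    ∃ c : k, (∀ x, f x = c • x) ∧ (l ≠ l' → c = 0) := by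
  obtain ⟨a, hf⟩ := exists_diagonal hdiag
  have e0 := hP ![1, 0, 1, 1] (by simp [mem_planeE7])
  have e1 := hP ![0, 1, 1, l] (by simp [mem_planeE7])
  simp [mem_planeE7, hf] at e0 e1
  refine ⟨a 0, fun x => ?_, fun hl => eq_zero_of_mul_eq (l := l) (l' := l') ?_ hl⟩
  · ext i
    fin_cases i <;> simp [hf] <;> grind
  · grind

theorem rigid_E8 {l l' : k} {f : (Fin 6 → k) →ₗ[k] (Fin 6 → k)}
    (hupper : ∀ i j : Fin 6, j.val < i.val → f (Pi.single j 1) i = 0)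
    (hlower : ∀ i j : Fin 6, (5 - j.val) / 2 < (5 - i.val) / 2 → f (Pi.single j 1) i = 0)
    (hP : ∀ x ∈ spaceE8 l, f x ∈ spaceE8 l') :
    ∃ c : k, (∀ x, f x = c • x) ∧ (l ≠ l' → c = 0) := by
  have hz : ∀ i j : Fin 6, (j.val < i.val ∨ (5 - j.val) / 2 < (5 - i.val) / 2) →
      f (Pi.single j 1) i = 0 := fun i j h => h.elim (hupper i j) (hlower i j)
  obtain ⟨a, b, hf⟩ : ∃ a b : Fin 6 → k, ∀ x,
      f x 0 = a 0 * x 0 + b 1 * x 1 ∧ f x 1 = a 1 * x 1 ∧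
      f x 2 = a 2 * x 2 + b 3 * x 3 ∧ f x 3 = a 3 * x 3 ∧
      f x 4 = a 4 * x 4 + b 5 * x 5 ∧ f x 5 = a 5 * x 5 := by
    refine ⟨fun i => f (Pi.single i 1) i, fun i => f (Pi.single i 1) (i - 1), fun x => ?_⟩
    refine ⟨?_, ?_, ?_, ?_, ?_, ?_⟩ <;> rw [apply_eq_sum, Fin.sum_univ_six] <;>
      simp [hz, mul_comm]
  have e0 := hP ![0, 1, 1, 0, 1, 0] (by simp [mem_spaceE8])
  have e1 := hP ![1, 0, 0, 1, 1, 0] (by simp [mem_spaceE8])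
  have e2 := hP ![1, 0, l, 0, 0, 1] (by simp [mem_spaceE8])
  simp [mem_spaceE8, hf] at e0 e1 e2
  refine ⟨a 0, fun x => ?_, fun hl => eq_zero_of_mul_eq (l := l) (l' := l') ?_ hl⟩
  · ext i
    fin_cases i <;> simp [hf] <;> grind
  · grind

end Flags

section Euclidean

/-- The star structure of `Ẽ₆`. -/
def starE6 : StarShape (fun i => (epE6 i).1) (fun i => (epE6 i).2) ![3, 3, 3] where
  root := 2
  arm := ![0, 0, 0, 1, 1, 2, 2]
  dep := ![2, 1, 0, 1, 2, 1, 2]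
  rank := ![2, 1, 0, 1, 2, 1, 2]
  par := ![1, 2, 2, 3, 2, 5]
  ch := ![0, 1, 3, 4, 5, 6]
  ends := by decide
  dep_root := rfl
  rank_lt := by decide
  eq_root_or := by decide
  ch_inj := by decide
  step := by decide
  dep_lt := by decide
  arm_dep_inj := by decide
  cover a j h0 h := by
    have : ∀ a : Fin 3, ∀ j < (![3, 3, 3] : Fin 3 → ℕ) a, 0 < j → ∃ v : Fin 7,
      (![0, 0, 0, 1, 1, 2, 2] : Fin 7 → Fin 3) v = a ∧
      (![2, 1, 0, 1, 2, 1, 2] : Fin 7 → ℕ) v = j := by decide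
    exact this a j h h0

/-- The star structure of `Ẽ₇`. -/
def starE7 : StarShape (fun i => (epE7 i).1) (fun i => (epE7 i).2) ![4, 4, 2] where
  root := 3
  arm := ![0, 0, 0, 0, 1, 1, 1, 2]
  dep := ![3, 2, 1, 0, 1, 2, 3, 1]
  rank := ![3, 2, 1, 0, 1, 2, 3, 1]
  par := ![1, 2, 3, 3, 4, 5, 3]
  ch := ![0, 1, 2, 4, 5, 6, 7]
  ends := by decide
  dep_root := rfl
  rank_lt := by decide
  eq_root_or := by decide
  ch_inj := by decide
  step := by decide
  dep_lt := by decide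
  arm_dep_inj := by decide
  cover a j h0 h := by
    have : ∀ a : Fin 3, ∀ j < (![4, 4, 2] : Fin 3 → ℕ) a, 0 < j → ∃ v : Fin 8,
      (![0, 0, 0, 0, 1, 1, 1, 2] : Fin 8 → Fin 3) v = a ∧
      (![3, 2, 1, 0, 1, 2, 3, 1] : Fin 8 → ℕ) v = j := by decide
    exact this a j h h0

/-- The star structure of `Ẽ₈`. -/
def starE8 : StarShape (fun i => (epE8 i).1) (fun i => (epE8 i).2) ![6, 3, 2] where
  root := 2
  arm := ![1, 1, 0, 0, 0, 0, 0, 0, 2]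
  dep := ![2, 1, 0, 1, 2, 3, 4, 5, 1]
  rank := ![2, 1, 0, 1, 2, 3, 4, 5, 1]
  par := ![1, 2, 2, 3, 4, 5, 6, 2]
  ch := ![0, 1, 3, 4, 5, 6, 7, 8]
  ends := by decide
  dep_root := rfl
  rank_lt := by decide
  eq_root_or := by decide
  ch_inj := by decide
  step := by decide
  dep_lt := by decide
  arm_dep_inj := by decide
  cover a j h0 h := by
    have : ∀ a : Fin 3, ∀ j < (![6, 3, 2] : Fin 3 → ℕ) a, 0 < j → ∃ v : Fin 9,
      (![1, 1, 0, 0, 0, 0, 0, 0, 2] : Fin 9 → Fin 3) v = a ∧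
      (![2, 1, 0, 1, 2, 3, 4, 5, 1] : Fin 9 → ℕ) v = j := by decide
    exact this a j h h0

/-- The star structure of `D̃_n`: all vertices but the four leaves have depth `0`. -/
def starD (n : ℕ) (hn : 4 ≤ n) :
    StarShape (fun i => (epD n hn i).1) (fun i => (epD n hn i).2) (fun _ : Fin 4 => 2) where
  root := ⟨2, by omega⟩
  arm v := if v.val = 0 then 0 else if v.val = 1 then 1 else if v.val = n - 1 then 2 else 3
  dep v := if v.val < 2 ∨ n - 1 ≤ v.val then 1 else 0
  rank v := if v.val < 2 then 3 else v.val
  par i := ⟨if i.val < 2 then 2 else if i.val = n - 1 then n - 2 else i.val, by grind⟩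
  ch i := ⟨if i.val < 2 then i.val else i.val + 1, by grind⟩
  ends i := by
    have := i.isLt
    simp only [epD, Fin.ext_iff]
    grind
  dep_root := by grind
  rank_lt i := by grind
  eq_root_or v := by
    have := v.isLt
    by_cases h : v.val < 2
    · exact Or.inr ⟨⟨v.val, by omega⟩, by simp [h]⟩
    · by_cases h2 : v.val = 2
      · exact Or.inl (Fin.ext h2)
      · refine Or.inr ⟨⟨v.val - 1, by omega⟩, ?_⟩
        ext
        grind
  ch_inj i i' h := by
    have := congrArg Fin.val h
    ext
    grind
  step i := by
    have := i.isLt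
    rcases lt_or_ge i.val 2 with h | h
    · grind
    · by_cases h1 : i.val = n - 1 <;> grind
  dep_lt v := by grind
  arm_dep_inj v v' h1 h2 h3 := by
    have := v.isLt
    have := v'.isLt
    ext
    grind
  cover a j h0 h := by
    obtain rfl : j = 1 := by omega
    fin_cases a
    · exact ⟨⟨0, by omega⟩, by simp⟩
    · exact ⟨⟨1, by omega⟩, by simp⟩
    · exact ⟨⟨n - 1, by omega⟩, by grind⟩
    · exact ⟨⟨n, by omega⟩, by grind⟩

variable {k : Type} [Field k] [Infinite k] {V E : Type} {s t : E → V}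

theorem exists_infinite_family_of_D {n : ℕ} {hn : 4 ≤ n}
    (h : IsShape s t (n + 1) n (epD n hn)) :
    ∃ f : ℕ → QRep k s t,
      (∀ j, (f j).FinDim ∧ (f j).Indecomposable) ∧
      (∀ i j, i ≠ j → ¬ Nonempty (QRep.Iso (f i) (f j))) := by
  obtain ⟨φ, ψ, h⟩ := h
  refine ((starD n hn).ofIsShape φ ψ h).exists_infinite_family
    (fun l a => shortFlag (lineD (![![0, 1], ![1, 0], ![1, -1], ![l, -1]] a)) ⊤)
    (fun l a => shortFlag_mono le_top) (fun l a => rfl) (fun l a => rfl) fun l l' f hf => ?_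
  exact rigid_lineD (hf 0 1 one_pos one_lt_two) (hf 1 1 one_pos one_lt_two)
    (hf 2 1 one_pos one_lt_two) (hf 3 1 one_pos one_lt_two)

theorem exists_infinite_family_of_E6 (h : IsShape s t 7 6 epE6) :
    ∃ f : ℕ → QRep k s t,
      (∀ j, (f j).FinDim ∧ (f j).Indecomposable) ∧
      (∀ i j, i ≠ j → ¬ Nonempty (QRep.Iso (f i) (f j))) := by
  obtain ⟨φ, ψ, h⟩ := h
  refine (starE6.ofIsShape φ ψ h).exists_infinite_family
    (fun l => ![coordFlag k (fun j : Fin 3 => j.val), coordFlag k (fun j : Fin 3 => 2 - j.val),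
      shortFlag (lineE6 l) (planeE6 k)]) ?_ ?_ ?_ ?_
  · intro l a
    fin_cases a
    · exact coordFlag_mono _
    · exact coordFlag_mono _
    · refine shortFlag_mono fun x hx => ?_
      rw [mem_lineE6] at hx
      rw [mem_planeE6]
      linear_combination hx.1 + hx.2
  · intro l a
    fin_cases a
    · exact coordFlag_zero _
    · exact coordFlag_zero _
    · rfl
  · intro l a
    fin_cases a
    · exact coordFlag_eq_top (by decide)
    · exact coordFlag_eq_top (by decide)
    · rfl
  · intro l l' f hf
    refine rigid_E6 (fun i j hij => ?_) (hf 2 1 (by decide) (by decide))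
      (hf 2 2 (by decide) (by decide))
    rcases lt_or_gt_of_ne hij with hlt | hlt
    · exact apply_single_eq_zero (m := 3) (by decide) (hf 1) (by omega)
    · exact apply_single_eq_zero (m := 3) (by decide) (hf 0) hlt

theorem exists_infinite_family_of_E7 (h : IsShape s t 8 7 epE7) :
    ∃ f : ℕ → QRep k s t,
      (∀ j, (f j).FinDim ∧ (f j).Indecomposable) ∧
      (∀ i j, i ≠ j → ¬ Nonempty (QRep.Iso (f i) (f j))) := by
  obtain ⟨φ, ψ, h⟩ := h
  refine (starE7.ofIsShape φ ψ h).exists_infinite_family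
    (fun l => ![coordFlag k (fun j : Fin 4 => j.val), coordFlag k (fun j : Fin 4 => 3 - j.val),
      shortFlag (planeE7 l) ⊤]) ?_ ?_ ?_ ?_
  · intro l a
    fin_cases a
    · exact coordFlag_mono _
    · exact coordFlag_mono _
    · exact shortFlag_mono le_top
  · intro l a
    fin_cases a
    · exact coordFlag_zero _
    · exact coordFlag_zero _
    · rfl
  · intro l a
    fin_cases a
    · exact coordFlag_eq_top (by decide)
    · exact coordFlag_eq_top (by decide)
    · rfl
  · intro l l' f hf
    refine rigid_E7 (fun i j hij => ?_) (hf 2 1 (by decide) (by decide))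
    rcases lt_or_gt_of_ne hij with hlt | hlt
    · exact apply_single_eq_zero (m := 4) (by decide) (hf 1) (by omega)
    · exact apply_single_eq_zero (m := 4) (by decide) (hf 0) hlt

theorem exists_infinite_family_of_E8 (h : IsShape s t 9 8 epE8) :
    ∃ f : ℕ → QRep k s t,
      (∀ j, (f j).FinDim ∧ (f j).Indecomposable) ∧
      (∀ i j, i ≠ j → ¬ Nonempty (QRep.Iso (f i) (f j))) := by
  obtain ⟨φ, ψ, h⟩ := h
  refine (starE8.ofIsShape φ ψ h).exists_infinite_family
    (fun l => ![coordFlag k (fun j : Fin 6 => j.val),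
      coordFlag k (fun j : Fin 6 => (5 - j.val) / 2), shortFlag (spaceE8 l) ⊤]) ?_ ?_ ?_ ?_
  · intro l a
    fin_cases a
    · exact coordFlag_mono _
    · exact coordFlag_mono _
    · exact shortFlag_mono le_top
  · intro l a
    fin_cases a
    · exact coordFlag_zero _
    · exact coordFlag_zero _
    · rfl
  · intro l a
    fin_cases a
    · exact coordFlag_eq_top (by decide)
    · exact coordFlag_eq_top (by decide)
    · rfl
  · intro l l' f hf
    exact rigid_E8 (fun i j hij => apply_single_eq_zero (m := 6) (by decide) (hf 0) hij)
      (fun i j hij => apply_single_eq_zero (m := 3) (by decide) (hf 1) hij)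
      (hf 2 1 (by decide) (by decide))

end Euclidean

end QRep

/-- Every quiver whose underlying graph is Euclidean of type
`Ã_n`, `D̃_n` (`n ≥ 4`), `Ẽ₆`, `Ẽ₇` or `Ẽ₈` is representation-infinite over any infinite
field: there are infinitely many pairwise non-isomorphic finite-dimensional indecomposable
representations. -/
theorem stmt19 (k : Type) [Field k] [Infinite k] {V E : Type} (s t : E → V)
    (hshape :
      (∃ n : ℕ, IsShape s t (n + 1) (n + 1) (epA n)) ∨
      (∃ (n : ℕ) (hn : 4 ≤ n), IsShape s t (n + 1) n (epD n hn)) ∨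
      IsShape s t 7 6 epE6 ∨ IsShape s t 8 7 epE7 ∨ IsShape s t 9 8 epE8) :
    ∃ f : ℕ → QRep k s t,
      (∀ j, (f j).FinDim ∧ (f j).Indecomposable) ∧
      (∀ i j, i ≠ j → ¬ Nonempty (QRep.Iso (f i) (f j))) := by
  rcases hshape with ⟨n, h⟩ | ⟨n, hn, h⟩ | h | h | h
  · exact QRep.exists_infinite_family_of_cycle h
  · exact QRep.exists_infinite_family_of_D h
  · exact QRep.exists_infinite_family_of_E6 h
  · exact QRep.exists_infinite_family_of_E7 h
  · exact QRep.exists_infinite_family_of_E8 h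
end
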